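/- For every real λ > 1 there exist a constant C > 0 and a threshold n₀ such that for every integer n ≥ n₀: ∑_{x ∈ T_n^{dep}} ∏_{y ∈ Set(x)} λ^{-1} y^{-α} ≤ C · n^{(1-2α)ε} log n, where the product runs over the distinct values y among the coordinates of x, and (1−2α)ε = −1/(g(2g+1)). -/

import Mathlib

noncomputable section

open Real MeasureTheory ProbabilityTheory

def IsSidonZ {M : ℕ} (S : Set (ZMod M)) : Prop :=
  ∀ a ∈ S, ∀ b ∈ S, ∀ c ∈ S, ∀ d ∈ S, a + b = c + d → ({a, b} : Set (ZMod M)) = {c, d}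

def Covers3 {M : ℕ} (S : Set (ZMod M)) : Prop :=
  ∀ z : ZMod M, ∃ s₁ ∈ S, ∃ s₂ ∈ S, ∃ s₃ ∈ S,
    s₁ ≠ s₂ ∧ s₁ ≠ s₃ ∧ s₂ ≠ s₃ ∧ z = s₁ + s₂ + s₃

def alph (g : ℕ) : ℝ := ((g : ℝ) + 1) / (2 * (g : ℝ) + 1)

def glam (g : ℕ) (lam : ℝ) (n : ℕ) : ℝ :=
  lam ^ ((2 * (g : ℝ) + 5) / (1 - alph g)) * (n : ℝ) ^ ((1 : ℝ) / (g : ℝ)) *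
    Real.log n ^ ((1 : ℝ) / (1 - alph g))

def GoodS (M : ℕ) (CM : Set (ZMod M)) (s : ℕ → Fin 3 → ZMod M) : Prop :=
  ∀ n : ℕ, (∀ i, s n i ∈ CM) ∧ s n 0 ≠ s n 1 ∧ s n 0 ≠ s n 2 ∧ s n 1 ≠ s n 2 ∧
    s n 0 + s n 1 + s n 2 = (n : ZMod M)

def Rtrip (g M : ℕ) (lam : ℝ) (s : ℕ → Fin 3 → ZMod M) (n x₁ x₂ x₃ : ℕ) : Prop :=
  0 < x₁ ∧ 0 < x₂ ∧ 0 < x₃ ∧ x₁ + x₂ + x₃ = n ∧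
  glam g lam n / 2 ≤ (x₁ : ℝ) ∧ (x₁ : ℝ) ≤ glam g lam n ∧
  (n : ℝ) / 4 ≤ (x₂ : ℝ) ∧ x₂ ≤ n ∧ (n : ℝ) / 4 ≤ (x₃ : ℝ) ∧ x₃ ≤ n ∧
  (x₁ : ZMod M) = s n 0 ∧ (x₂ : ZMod M) = s n 1 ∧ (x₃ : ZMod M) = s n 2

def Rn (g M : ℕ) (lam : ℝ) (s : ℕ → Fin 3 → ZMod M) (n : ℕ) : Set (Finset ℕ) :=
  {ω | ∃ x₁ x₂ x₃ : ℕ, ω = {x₁, x₂, x₃} ∧ Rtrip g M lam s n x₁ x₂ x₃}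

def imgF {m : ℕ} (x : Fin m → ℕ) : Finset ℕ := Finset.image x Finset.univ

def firstThree (g : ℕ) (x : Fin (2 * g + 4) → ℕ) : Finset ℕ :=
  {x ⟨0, by omega⟩, x ⟨1, by omega⟩, x ⟨2, by omega⟩}

def pairOf (g : ℕ) (x : Fin (2 * g + 4) → ℕ) (j : ℕ) : Finset ℕ :=
  if j = 0 then {x ⟨0, by omega⟩, x ⟨3, by omega⟩}
  else if h : j ≤ g then {x ⟨2 * j + 2, by omega⟩, x ⟨2 * j + 3, by omega⟩}
  else ∅

def Tn (g M : ℕ) (lam : ℝ) (s : ℕ → Fin 3 → ZMod M) (n : ℕ) :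
    Set (Fin (2 * g + 4) → ℕ) :=
  {x | (∀ i, 0 < x i) ∧
    firstThree g x ∈ Rn g M lam s n ∧
    (∀ j : ℕ, 2 ≤ j → ∀ _ : j ≤ g + 1,
      x ⟨0, by omega⟩ + x ⟨3, by omega⟩ = x ⟨2 * j, by omega⟩ + x ⟨2 * j + 1, by omega⟩) ∧
    (∀ i : Fin (2 * g + 4), 3 ≤ (i : ℕ) → x i ≤ x ⟨0, by omega⟩) ∧
    (∀ k : ℕ, 2 ≤ k → ∀ _ : k ≤ g + 1,
      (x ⟨2 * k, by omega⟩ : ZMod M) = (x ⟨0, by omega⟩ : ZMod M) ∧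
      (x ⟨2 * k + 1, by omega⟩ : ZMod M) = (x ⟨3, by omega⟩ : ZMod M)) ∧
    (∀ j k : ℕ, j ≤ g → k ≤ g → j ≠ k → pairOf g x j ≠ pairOf g x k)}

def TnInd (g M : ℕ) (lam : ℝ) (s : ℕ → Fin 3 → ZMod M) (n : ℕ) :
    Set (Fin (2 * g + 4) → ℕ) :=
  {x ∈ Tn g M lam s n | Function.Injective x}

def TnDep (g M : ℕ) (lam : ℝ) (s : ℕ → Fin 3 → ZMod M) (n : ℕ) :
    Set (Fin (2 * g + 4) → ℕ) :=
  {x ∈ Tn g M lam s n | ¬ Function.Injective x}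

def Vr (g : ℕ) (r₁ : ℕ) : Set (Fin (2 * g + 1) → ℕ) :=
  {v | (∀ i, 0 < v i) ∧
    (∀ t : ℕ, ∀ _ : t < g,
      r₁ + v ⟨0, by omega⟩ = v ⟨2 * t + 1, by omega⟩ + v ⟨2 * t + 2, by omega⟩) ∧
    (∀ i, v i ≤ r₁) ∧ Function.Injective v ∧ (∀ i, v i ≠ r₁)}

def Tcal (X r : Finset ℕ) (k : ℕ) (eps : ℕ → ℤ) : Set (ℕ → ℕ) :=
  {y | (∀ j < k, y j ∈ X ∪ r) ∧ (∀ j, k ≤ j → y j = 0) ∧ (∃ j < k, y j ∈ X) ∧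
    (∀ i < k, ∀ j < k, y i = y j → eps i = eps j)}

def Fval (k : ℕ) (eps : ℕ → ℤ) (y : ℕ → ℕ) : ℤ :=
  ∑ j ∈ Finset.range k, eps j * (y j : ℤ)

def Ccal (U X r : Finset ℕ) : Set (Finset ℕ) :=
  {w | w.card = 4 ∧ w ⊆ U ∧ (∃ a ∈ w, a ∈ X ∧ a ∉ r) ∧
    ∃ y₁ y₂ y₃ y₄ : ℕ, w = {y₁, y₂, y₃, y₄} ∧ y₁ + y₂ = y₃ + y₄ ∧
      ({y₁, y₂} : Finset ℕ) ≠ {y₃, y₄}}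

def CcalR (g M : ℕ) (lam : ℝ) (s : ℕ → Fin 3 → ZMod M) (n : ℕ) (X r : Finset ℕ) :
    Set (Finset ℕ) :=
  {w | w ∈ Rn g M lam s n ∧ w ⊆ X ∪ r ∧ ∃ a ∈ w, a ∈ X ∧ a ∉ r}

def Sx (g : ℕ) (x : Fin (2 * g + 4) → ℕ) : Set (Finset ℕ) :=
  {w | ∃ l : ℕ, ∃ _ : 3 ≤ l, ∃ _ : l ≤ g + 2,
      w = ({x ⟨0, by omega⟩, x ⟨3, by omega⟩,
            x ⟨2 * l - 2, by omega⟩, x ⟨2 * l - 1, by omega⟩} : Finset ℕ)} ∪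
  {w | ∃ l j : ℕ, ∃ _ : 3 ≤ l, ∃ _ : l < j, ∃ _ : j ≤ g + 2,
      w = ({x ⟨2 * j - 2, by omega⟩, x ⟨2 * j - 1, by omega⟩,
            x ⟨2 * l - 2, by omega⟩, x ⟨2 * l - 1, by omega⟩} : Finset ℕ)}

def SxV (g : ℕ) (r₁ : ℕ) (v : Fin (2 * g + 1) → ℕ) : Set (Finset ℕ) :=
  {w | ∃ l : ℕ, ∃ _ : 3 ≤ l, ∃ _ : l ≤ g + 2,
      w = ({r₁, v ⟨0, by omega⟩, v ⟨2 * l - 5, by omega⟩, v ⟨2 * l - 4, by omega⟩} : Finset ℕ)} ∪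
  {w | ∃ l j : ℕ, ∃ _ : 3 ≤ l, ∃ _ : l < j, ∃ _ : j ≤ g + 2,
      w = ({v ⟨2 * j - 5, by omega⟩, v ⟨2 * j - 4, by omega⟩,
            v ⟨2 * l - 5, by omega⟩, v ⟨2 * l - 4, by omega⟩} : Finset ℕ)}

def tailSet (g : ℕ) (x : Fin (2 * g + 4) → ℕ) : Finset ℕ :=
  Finset.image (fun i : Fin (2 * g + 1) => x ⟨(i : ℕ) + 3, by have := i.isLt; omega⟩)
    Finset.univ

/-- The weight `k ^ (-α)` of a natural number. -/
def powWt (α : ℝ) (k : ℕ) : ℝ := (k : ℝ) ^ (-α)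

lemma powWt_nonneg (α : ℝ) (k : ℕ) : 0 ≤ powWt α k := by
  unfold powWt; positivity

lemma powWt_anti {α : ℝ} (hα : 0 ≤ α) {i j : ℕ} (hi : 1 ≤ i) (hij : i ≤ j) :
    powWt α j ≤ powWt α i := by
  unfold powWt
  exact Real.rpow_le_rpow_of_nonpos (by exact_mod_cast hi) (by exact_mod_cast hij) (by linarith)

lemma powWt_le_one {α : ℝ} (hα : 0 < α) (k : ℕ) : powWt α k ≤ 1 := by
  rcases Nat.eq_zero_or_pos k with rfl | hk
  · unfold powWt
    rw [Nat.cast_zero, Real.zero_rpow (by linarith)]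
    exact zero_le_one
  · unfold powWt
    exact Real.rpow_le_one_of_one_le_of_nonpos (by exact_mod_cast hk) (by linarith)

lemma sum_powWt_le {α : ℝ} (h0 : 0 < α) (h1 : α < 1) (N : ℕ) :
    ∑ k ∈ Finset.Icc 1 N, powWt α k ≤ (N : ℝ) ^ (1 - α) / (1 - α) := by
  induction N with
  | zero => simp [Real.zero_rpow (by linarith : 1 - α ≠ 0)]
  | succ N ih =>
    rw [Finset.sum_Icc_succ_top (by omega)]
    have hx : (0 : ℝ) < ((N + 1 : ℕ) : ℝ) := by positivity
    set x : ℝ := ((N + 1 : ℕ) : ℝ) with hxdef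
    have hN : (N : ℝ) = x * (1 + (-x⁻¹)) := by
      rw [hxdef]; push_cast; field_simp; ring
    have hxi : x⁻¹ ≤ 1 := by
      apply inv_le_one_of_one_le₀; rw [hxdef]; push_cast; linarith [Nat.cast_nonneg (α := ℝ) N]
    have hb : (1 + (-x⁻¹)) ^ (1 - α) ≤ 1 + (1 - α) * (-x⁻¹) :=
      rpow_one_add_le_one_add_mul_self (by linarith) (by linarith) (by linarith)
    have hsplit : x ^ (-α) = x ^ (1 - α) * x⁻¹ := by
      rw [← Real.rpow_neg_one x, ← Real.rpow_add hx]; congr 1; ring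
    have hpos : 0 < x ^ (1 - α) := by positivity
    have hNle : (N : ℝ) ^ (1 - α) ≤ x ^ (1 - α) * (1 + (1 - α) * (-x⁻¹)) := by
      rw [hN, Real.mul_rpow hx.le (by linarith)]
      gcongr
    have h1' : 0 < 1 - α := by linarith
    unfold powWt at ih ⊢
    rw [le_div_iff₀ h1'] at ih ⊢
    rw [← hxdef, add_mul, hsplit]
    nlinarith

lemma sum_powWt_reflect (α : ℝ) (N : ℕ) :
    ∑ k ∈ Finset.Icc 1 N, powWt α (N + 1 - k) = ∑ k ∈ Finset.Icc 1 N, powWt α k := by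
  refine Finset.sum_nbij' (fun k => N + 1 - k) (fun k => N + 1 - k) ?_ ?_ ?_ ?_ ?_
  all_goals
    intro k hk
    rw [Finset.mem_Icc] at *
    try omega

lemma sum_powWt_sq_le {α : ℝ} (h : 1 / 2 < α) :
    ∃ C : ℝ, 0 < C ∧ ∀ N : ℕ, ∑ k ∈ Finset.Icc 1 N, powWt α k * powWt α k ≤ C := by
  have hs : Summable (fun k : ℕ => (k : ℝ) ^ (-(2 * α))) :=
    Real.summable_nat_rpow.2 (by linarith)
  refine ⟨∑' k : ℕ, (k : ℝ) ^ (-(2 * α)) + 1, ?_, fun N => ?_⟩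
  · have : 0 ≤ ∑' k : ℕ, (k : ℝ) ^ (-(2 * α)) := tsum_nonneg fun k => by positivity
    linarith
  · have h2 : ∑ k ∈ Finset.Icc 1 N, powWt α k * powWt α k
        = ∑ k ∈ Finset.Icc 1 N, (k : ℝ) ^ (-(2 * α)) := by
      refine Finset.sum_congr rfl fun k hk => ?_
      rw [Finset.mem_Icc] at hk
      unfold powWt
      rw [← Real.rpow_add (by exact_mod_cast hk.1)]
      congr 1; ring
    rw [h2]
    have := hs.sum_le_tsum (Finset.Icc 1 N) (fun k _ => by positivity)
    linarith

/-- The bound `(X / 2) ^ (-α)` for the weight of a number that is at least `X / 2`. -/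
def halfWt (α : ℝ) (X : ℕ) : ℝ := ((X : ℝ) / 2) ^ (-α)

lemma halfWt_nonneg (α : ℝ) (X : ℕ) : 0 ≤ halfWt α X := by
  unfold halfWt; positivity

lemma powWt_le_halfWt {α : ℝ} (hα : 0 ≤ α) {X k : ℕ} (hX : 1 ≤ X) (hk : X ≤ 2 * k) :
    powWt α k ≤ halfWt α X := by
  unfold powWt halfWt
  have h1 : (0 : ℝ) < X := by exact_mod_cast hX
  have h2 : (X : ℝ) ≤ 2 * k := by exact_mod_cast hk
  exact Real.rpow_le_rpow_of_nonpos (by linarith) (by linarith) (by linarith)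

lemma halfWt_eq {α : ℝ} (X : ℕ) : halfWt α X = 2 ^ α * (X : ℝ) ^ (-α) := by
  unfold halfWt
  rw [Real.div_rpow (by positivity) (by norm_num), Real.rpow_neg (by norm_num : (0 : ℝ) ≤ 2)]
  field_simp

/-- The contribution of a pair `{y, X + c - y}` that is degenerate or contains `a`. -/
def speWt (α : ℝ) (X a c y : ℕ) : ℝ :=
  if y = a ∨ y + a = X + c ∨ 2 * y = X + c then halfWt α X else 0

/-- The majorant for a pair `{y, X + c - y}` that avoids the exceptional value `b`. -/
def pairWt (α : ℝ) (X a c y : ℕ) : ℝ :=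
  powWt α y * powWt α (X + c - y) + speWt α X a c y

/-- Indicator of `c` being one of the three values `X`, `a`, `b`. -/
def excInd (X a b c : ℕ) : ℝ := if c = X ∨ c = a ∨ c = b then 1 else 0

/-- Indicator of `c` for which the partner of `b` is `a` or `b`. -/
def parInd (X a b c : ℕ) : ℝ := if X + c = a + b ∨ X + c = 2 * b then 1 else 0

/-- The majorant for a pair `{y, X + c - y}` that contains `b`. -/
def hitWt (α : ℝ) (X a b c y : ℕ) : ℝ :=
  if y = b ∨ y + b = X + c then powWt α c + parInd X a b c else 0

/-- The majorant for the dependent tails. -/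
def tailMaj (α : ℝ) (g X a b c : ℕ) (y : Fin g → ℕ) : ℝ :=
  excInd X a b c * ∏ j, pairWt α X a c (y j) +
    (powWt α c + excInd X a b c) *
      ∑ j, ∏ i, if i = j then speWt α X a c (y i) + hitWt α X a b c (y i)
        else pairWt α X a c (y i)

lemma speWt_nonneg (α : ℝ) (X a c y : ℕ) : 0 ≤ speWt α X a c y := by
  unfold speWt; split_ifs
  · exact halfWt_nonneg α X
  · exact le_rfl

lemma pairWt_nonneg (α : ℝ) (X a c y : ℕ) : 0 ≤ pairWt α X a c y :=
  add_nonneg (mul_nonneg (powWt_nonneg _ _) (powWt_nonneg _ _)) (speWt_nonneg _ _ _ _ _)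

lemma excInd_nonneg (X a b c : ℕ) : 0 ≤ excInd X a b c := by
  unfold excInd; split_ifs <;> norm_num

lemma parInd_nonneg (X a b c : ℕ) : 0 ≤ parInd X a b c := by
  unfold parInd; split_ifs <;> norm_num

lemma hitWt_nonneg (α : ℝ) (X a b c y : ℕ) : 0 ≤ hitWt α X a b c y := by
  unfold hitWt; split_ifs
  · exact add_nonneg (powWt_nonneg _ _) (parInd_nonneg _ _ _ _)
  · exact le_rfl

lemma tailMaj_nonneg (α : ℝ) (g X a b c : ℕ) (y : Fin g → ℕ) : 0 ≤ tailMaj α g X a b c y := by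
  refine add_nonneg (mul_nonneg (excInd_nonneg _ _ _ _)
    (Finset.prod_nonneg fun j _ => pairWt_nonneg _ _ _ _ _))
    (mul_nonneg (add_nonneg (powWt_nonneg _ _) (excInd_nonneg _ _ _ _))
      (Finset.sum_nonneg fun j _ => Finset.prod_nonneg fun i _ => ?_))
  split_ifs
  · exact add_nonneg (speWt_nonneg _ _ _ _ _) (hitWt_nonneg _ _ _ _ _ _)
  · exact pairWt_nonneg _ _ _ _ _

lemma sum_ite_le_of_unique {ι : Type*} (s : Finset ι) (p : ι → Prop) [DecidablePred p]
    (hp : ∀ i ∈ s, ∀ j ∈ s, p i → p j → i = j) {K : ℝ} (hK : 0 ≤ K) :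
    ∑ i ∈ s, (if p i then K else 0) ≤ K := by
  rw [← Finset.sum_filter, Finset.sum_const, nsmul_eq_mul]
  have : (s.filter p).card ≤ 1 := by
    rw [Finset.card_le_one]
    intro i hi j hj
    rw [Finset.mem_filter] at hi hj
    exact hp i hi.1 j hj.1 hi.2 hj.2
  have h2 : ((s.filter p).card : ℝ) ≤ 1 := by exact_mod_cast this
  nlinarith

lemma ite_or_le {p q : Prop} [Decidable p] [Decidable q] {K : ℝ} (hK : 0 ≤ K) :
    (if p ∨ q then K else 0) ≤ (if p then K else 0) + (if q then K else 0) := by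
  by_cases hp : p <;> by_cases hq : q <;> simp [hp, hq, hK]

lemma sum_speWt_le (α : ℝ) (X a c : ℕ) (s : Finset ℕ) :
    ∑ y ∈ s, speWt α X a c y ≤ 3 * halfWt α X := by
  have hK := halfWt_nonneg α X
  have h1 := sum_ite_le_of_unique s (fun y => y = a) (by intros; omega) hK
  have h2 := sum_ite_le_of_unique s (fun y => y + a = X + c) (by intros; omega) hK
  have h3 := sum_ite_le_of_unique s (fun y => 2 * y = X + c) (by intros; omega) hK
  have : ∑ y ∈ s, speWt α X a c y ≤ ∑ y ∈ s, ((if y = a then halfWt α X else 0) +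
      ((if y + a = X + c then halfWt α X else 0) +
      (if 2 * y = X + c then halfWt α X else 0))) := by
    refine Finset.sum_le_sum fun y _ => ?_
    unfold speWt
    exact (ite_or_le hK).trans (add_le_add le_rfl (ite_or_le hK))
  rw [Finset.sum_add_distrib, Finset.sum_add_distrib] at this
  linarith

lemma sum_excInd_le (X a b : ℕ) (s : Finset ℕ) : ∑ c ∈ s, excInd X a b c ≤ 3 := by
  have hK := zero_le_one (α := ℝ)
  have h1 := sum_ite_le_of_unique s (fun c => c = X) (by intros; omega) hK
  have h2 := sum_ite_le_of_unique s (fun c => c = a) (by intros; omega) hK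
  have h3 := sum_ite_le_of_unique s (fun c => c = b) (by intros; omega) hK
  have : ∑ c ∈ s, excInd X a b c ≤ ∑ c ∈ s, ((if c = X then (1 : ℝ) else 0) +
      ((if c = a then (1 : ℝ) else 0) + (if c = b then (1 : ℝ) else 0))) := by
    refine Finset.sum_le_sum fun y _ => ?_
    unfold excInd
    exact (ite_or_le hK).trans (add_le_add le_rfl (ite_or_le hK))
  rw [Finset.sum_add_distrib, Finset.sum_add_distrib] at this
  linarith

lemma sum_parInd_le (X a b : ℕ) (s : Finset ℕ) : ∑ c ∈ s, parInd X a b c ≤ 2 := by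
  have hK := zero_le_one (α := ℝ)
  have h1 := sum_ite_le_of_unique s (fun c => X + c = a + b) (by intros; omega) hK
  have h2 := sum_ite_le_of_unique s (fun c => X + c = 2 * b) (by intros; omega) hK
  have : ∑ c ∈ s, parInd X a b c ≤ ∑ c ∈ s, ((if X + c = a + b then (1 : ℝ) else 0) +
      (if X + c = 2 * b then (1 : ℝ) else 0)) := by
    refine Finset.sum_le_sum fun y _ => ?_
    unfold parInd
    exact ite_or_le hK
  rw [Finset.sum_add_distrib] at this
  linarith

lemma sum_hitWt_le (α : ℝ) (X a b c : ℕ) (s : Finset ℕ) :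
    ∑ y ∈ s, hitWt α X a b c y ≤ 2 * (powWt α c + parInd X a b c) := by
  have hK := add_nonneg (powWt_nonneg α c) (parInd_nonneg X a b c)
  have h1 := sum_ite_le_of_unique s (fun y => y = b) (by intros; omega) hK
  have h2 := sum_ite_le_of_unique s (fun y => y + b = X + c) (by intros; omega) hK
  have : ∑ y ∈ s, hitWt α X a b c y ≤ ∑ y ∈ s,
      ((if y = b then powWt α c + parInd X a b c else 0) +
      (if y + b = X + c then powWt α c + parInd X a b c else 0)) := by
    refine Finset.sum_le_sum fun y _ => ?_
    unfold hitWt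
    exact ite_or_le hK
  rw [Finset.sum_add_distrib] at this
  linarith

lemma sum_pairWt_le {α : ℝ} (h0 : 1 / 2 < α) (h1 : α < 1) :
    ∃ C : ℝ, 0 < C ∧ ∀ X a c : ℕ, 1 ≤ X → 1 ≤ c →
      ∑ y ∈ Finset.Icc 1 X, pairWt α X a c y ≤ C * (X : ℝ) ^ (1 - 2 * α) := by
  have h1' : 0 < 1 - α := by linarith
  refine ⟨2 ^ α * (2 / (1 - α) + 3), by positivity, fun X a c hX hc => ?_⟩
  have hX0 : (0 : ℝ) < X := by exact_mod_cast hX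
  have hX1 : (1 : ℝ) ≤ X := by exact_mod_cast hX
  have key : ∀ y ∈ Finset.Icc 1 X, pairWt α X a c y ≤
      halfWt α X * (powWt α y + powWt α (X + 1 - y)) + speWt α X a c y := by
    intro y hy
    rw [Finset.mem_Icc] at hy
    unfold pairWt
    refine add_le_add ?_ le_rfl
    have e1 : powWt α (X + c - y) ≤ powWt α (X + 1 - y) :=
      powWt_anti (by linarith) (by omega) (by omega)
    have p1 := powWt_nonneg α y
    have p2 := powWt_nonneg α (X + c - y)
    have p3 := powWt_nonneg α (X + 1 - y)
    have p4 := halfWt_nonneg α X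
    rcases le_or_gt X (2 * y) with h | h
    · have := powWt_le_halfWt (α := α) (by linarith) hX h
      nlinarith [mul_le_mul this e1 p2 p4]
    · have := powWt_le_halfWt (α := α) (k := X + c - y) (by linarith) hX (by omega)
      nlinarith [mul_le_mul_of_nonneg_left this p1]
  have hS := sum_powWt_le (by linarith : 0 < α) h1 X
  have h2 := sum_speWt_le α X a c (Finset.Icc 1 X)
  have h3 := Finset.sum_le_sum key
  rw [Finset.sum_add_distrib, ← Finset.mul_sum, Finset.sum_add_distrib,
    sum_powWt_reflect] at h3
  have hmul : (X : ℝ) ^ (-α) * (X : ℝ) ^ (1 - α) = (X : ℝ) ^ (1 - 2 * α) := by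
    rw [← Real.rpow_add hX0]; congr 1; ring
  have hle : (X : ℝ) ^ (-α) ≤ (X : ℝ) ^ (1 - 2 * α) :=
    Real.rpow_le_rpow_of_exponent_le hX1 (by linarith)
  have hK := halfWt_eq (α := α) X
  have hKn := halfWt_nonneg α X
  have t2 : (0 : ℝ) < 2 ^ α := by positivity
  calc _ ≤ halfWt α X * (2 * ((X : ℝ) ^ (1 - α) / (1 - α))) + 3 * halfWt α X := by
        nlinarith
    _ = 2 ^ α * (2 / (1 - α) * ((X : ℝ) ^ (-α) * (X : ℝ) ^ (1 - α)) + 3 * (X : ℝ) ^ (-α)) := by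
        rw [hK]; ring
    _ ≤ 2 ^ α * (2 / (1 - α) * (X : ℝ) ^ (1 - 2 * α) + 3 * (X : ℝ) ^ (1 - 2 * α)) := by
        rw [hmul]; gcongr
    _ = _ := by ring

lemma sum_pi_prod_ite {g : ℕ} (s : Finset ℕ) (f h : ℕ → ℝ) (j : Fin g) :
    ∑ y ∈ Fintype.piFinset (fun _ : Fin g => s), ∏ i, (if i = j then h (y i) else f (y i)) =
      (∑ k ∈ s, h k) * (∑ k ∈ s, f k) ^ (g - 1) := by
  have := Finset.prod_univ_sum (fun _ : Fin g => s)
    (fun i k => if i = j then h k else f k)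
  rw [← this, ← Finset.mul_prod_erase _ _ (Finset.mem_univ j)]
  congr 1
  · simp
  · rw [Finset.prod_congr rfl (g := fun _ => ∑ k ∈ s, f k), Finset.prod_const,
      Finset.card_erase_of_mem (Finset.mem_univ j), Finset.card_univ, Fintype.card_fin]
    intro i hi
    rw [Finset.mem_erase] at hi
    simp [hi.1]

lemma sum_tailMaj_le {α : ℝ} (h0 : 1 / 2 < α) (h1 : α < 1) {g : ℕ} (hg : 2 ≤ g) :
    ∃ C : ℝ, 0 < C ∧ ∀ X a b : ℕ, 1 ≤ X →
      ∑ c ∈ Finset.Icc 1 X, ∑ y ∈ Fintype.piFinset (fun _ : Fin g => Finset.Icc 1 X),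
        tailMaj α g X a b c y ≤ C * (X : ℝ) ^ (1 - 2 * α) := by
  obtain ⟨C₁, hC₁, hpair⟩ := sum_pairWt_le h0 h1
  obtain ⟨C₂, hC₂, hsq⟩ := sum_powWt_sq_le h0
  have h1' : 0 < 1 - α := by linarith
  set D : ℝ := 1 / (1 - α) with hD
  have hDpos : 0 < D := by positivity
  refine ⟨3 * C₁ ^ g + g * C₁ ^ (g - 1) * (3 * 2 ^ α * (D + 3) + (2 * C₂ + 16)),
    by positivity, fun X a b hX => ?_⟩
  have hX0 : (0 : ℝ) < X := by exact_mod_cast hX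
  have hX1 : (1 : ℝ) ≤ X := by exact_mod_cast hX
  set U : ℝ := (X : ℝ) ^ (1 - 2 * α) with hU
  have hU0 : 0 < U := by positivity
  have hU1 : U ≤ 1 := Real.rpow_le_one_of_one_le_of_nonpos hX1 (by linarith)
  have hpow : ∀ k : ℕ, 1 ≤ k → U ^ k ≤ U := fun k hk =>
    pow_le_of_le_one hU0.le hU1 (by omega)
  have step : ∀ c ∈ Finset.Icc 1 X,
      ∑ y ∈ Fintype.piFinset (fun _ : Fin g => Finset.Icc 1 X), tailMaj α g X a b c y ≤
        excInd X a b c * (C₁ ^ g * U) + (powWt α c + excInd X a b c) *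
          (g * ((3 * halfWt α X + 2 * (powWt α c + parInd X a b c)) * (C₁ ^ (g - 1) * U))) := by
    intro c hc
    rw [Finset.mem_Icc] at hc
    have hP := hpair X a c hX hc.1
    have hP0 : 0 ≤ ∑ k ∈ Finset.Icc 1 X, pairWt α X a c k :=
      Finset.sum_nonneg fun k _ => pairWt_nonneg _ _ _ _ _
    have hPk : ∀ k : ℕ, 1 ≤ k →
        (∑ k ∈ Finset.Icc 1 X, pairWt α X a c k) ^ k ≤ C₁ ^ k * U := by
      intro k hk
      calc _ ≤ (C₁ * U) ^ k := by gcongr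
        _ = C₁ ^ k * U ^ k := mul_pow _ _ _
        _ ≤ C₁ ^ k * U := by gcongr; exact hpow k hk
    unfold tailMaj
    rw [Finset.sum_add_distrib, ← Finset.mul_sum, ← Finset.mul_sum, Finset.sum_comm]
    have e1 : ∑ y ∈ Fintype.piFinset (fun _ : Fin g => Finset.Icc 1 X),
        ∏ j, pairWt α X a c (y j) = (∑ k ∈ Finset.Icc 1 X, pairWt α X a c k) ^ g := by
      rw [← Finset.prod_univ_sum (fun _ : Fin g => Finset.Icc 1 X)
        (fun _ k => pairWt α X a c k)]
      simp
    rw [e1]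
    have hex := excInd_nonneg X a b c
    have hpw := powWt_nonneg α c
    have hpr := parInd_nonneg X a b c
    have hhw := halfWt_nonneg α X
    refine add_le_add (mul_le_mul_of_nonneg_left (hPk g (by omega)) hex)
      (mul_le_mul_of_nonneg_left ?_ (add_nonneg hpw hex))
    have hterm : ∀ j ∈ (Finset.univ : Finset (Fin g)),
        ∑ y ∈ Fintype.piFinset (fun _ : Fin g => Finset.Icc 1 X),
          ∏ i, (if i = j then speWt α X a c (y i) + hitWt α X a b c (y i)
            else pairWt α X a c (y i)) ≤
        (3 * halfWt α X + 2 * (powWt α c + parInd X a b c)) * (C₁ ^ (g - 1) * U) := by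
      intro j _
      rw [sum_pi_prod_ite (Finset.Icc 1 X) (fun k => pairWt α X a c k)
        (fun k => speWt α X a c k + hitWt α X a b c k) j, Finset.sum_add_distrib]
      refine mul_le_mul (add_le_add (sum_speWt_le _ _ _ _ _) (sum_hitWt_le _ _ _ _ _ _))
        (hPk (g - 1) (by omega)) (by positivity) (by positivity)
    refine (Finset.sum_le_sum hterm).trans ?_
    rw [Finset.sum_const, Finset.card_univ, Fintype.card_fin, nsmul_eq_mul]
  refine (Finset.sum_le_sum step).trans ?_
  set V : ℝ := C₁ ^ (g - 1) * U with hV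
  have hV0 : 0 ≤ V := by positivity
  have pointwise : ∀ c ∈ Finset.Icc 1 X,
      excInd X a b c * (C₁ ^ g * U) + (powWt α c + excInd X a b c) *
          (g * ((3 * halfWt α X + 2 * (powWt α c + parInd X a b c)) * V)) ≤
      excInd X a b c * (C₁ ^ g * U) + (g * V) * (3 * halfWt α X *
        (powWt α c + excInd X a b c) + (2 * (powWt α c * powWt α c) +
          4 * excInd X a b c + 2 * parInd X a b c)) := by
    intro c _
    have hpw := powWt_nonneg α c
    have hpw1 := powWt_le_one (by linarith : 0 < α) c
    have hpr := parInd_nonneg X a b c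
    have hex := excInd_nonneg X a b c
    have hpr1 : parInd X a b c ≤ 1 := by unfold parInd; split_ifs <;> norm_num
    have : (powWt α c + excInd X a b c) * (2 * (powWt α c + parInd X a b c)) ≤
        2 * (powWt α c * powWt α c) + 4 * excInd X a b c + 2 * parInd X a b c := by
      nlinarith [mul_nonneg hex (sub_nonneg.2 hpw1), mul_nonneg hex (sub_nonneg.2 hpr1),
        mul_nonneg hpr (sub_nonneg.2 hpw1)]
    have hgV : 0 ≤ (g : ℝ) * V := by positivity
    nlinarith [mul_le_mul_of_nonneg_left this hgV]
  refine (Finset.sum_le_sum pointwise).trans ?_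
  rw [Finset.sum_add_distrib, ← Finset.sum_mul, ← Finset.mul_sum, Finset.sum_add_distrib,
    ← Finset.mul_sum, Finset.sum_add_distrib, Finset.sum_add_distrib, Finset.sum_add_distrib,
    ← Finset.mul_sum, ← Finset.mul_sum, ← Finset.mul_sum]
  have s1 := sum_excInd_le X a b (Finset.Icc 1 X)
  have s2 := sum_powWt_le (by linarith : 0 < α) h1 X
  have s3 := hsq X
  have s4 := sum_parInd_le X a b (Finset.Icc 1 X)
  have hhw := halfWt_nonneg α X
  have hhalf : halfWt α X * (∑ c ∈ Finset.Icc 1 X, powWt α c +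
      ∑ c ∈ Finset.Icc 1 X, excInd X a b c) ≤ 2 ^ α * (D + 3) := by
    have t2 : (0 : ℝ) < 2 ^ α := by positivity
    calc _ ≤ halfWt α X * ((X : ℝ) ^ (1 - α) / (1 - α) + 3) := by gcongr
      _ = 2 ^ α * (D * ((X : ℝ) ^ (-α) * (X : ℝ) ^ (1 - α)) + 3 * (X : ℝ) ^ (-α)) := by
        rw [halfWt_eq, hD]; ring
      _ = 2 ^ α * (D * U + 3 * (X : ℝ) ^ (-α)) := by
        rw [← Real.rpow_add hX0, hU]; congr 4; ring
      _ ≤ 2 ^ α * (D * 1 + 3 * 1) := by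
        gcongr
        exact Real.rpow_le_one_of_one_le_of_nonpos hX1 (by linarith)
      _ = _ := by ring
  calc _ ≤ 3 * (C₁ ^ g * U) + (g * V) * (3 * (2 ^ α * (D + 3)) + (2 * C₂ + 4 * 3 + 2 * 2)) := by
        rw [mul_assoc 3 (halfWt α X)]
        gcongr
    _ = _ := by rw [hV]; ring

lemma prod_le_of_mem {ω : ℕ → ℝ} (h0 : ∀ k, 0 ≤ ω k) (h1 : ∀ k, ω k ≤ 1) {s : Finset ℕ} {k : ℕ}
    (hk : k ∈ s) : ∏ i ∈ s, ω i ≤ ω k := by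
  rw [← Finset.mul_prod_erase _ _ hk]
  exact mul_le_of_le_one_right (h0 k) (Finset.prod_le_one (fun i _ => h0 i) fun i _ => h1 i)

lemma tail_prod_le {α : ℝ} (hα : 1 / 2 < α) {ω : ℕ → ℝ} (h0 : ∀ k, 0 ≤ ω k)
    (hw : ∀ k, ω k ≤ powWt α k) {g X a b c : ℕ} {y z : Fin g → ℕ} (hX : 1 ≤ X) (hc : 1 ≤ c)
    (hyX : ∀ j, y j ≤ X) (hzX : ∀ j, z j ≤ X)
    (hyz : ∀ j, y j + z j = X + c) (hyne : ∀ j, y j ≠ X) (hzne : ∀ j, z j ≠ X)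
    (hb : ∀ i j, (y i = b ∨ z i = b) → (y j = b ∨ z j = b) → i = j)
    (ha : a ≤ X → 2 * a ≤ X)
    (hdep : (c = X ∨ c = a ∨ c = b) ∨ ∃ j, y j = z j ∨ y j = a ∨ z j = a ∨ y j = b ∨ z j = b) :
    (∏ k ∈ {c} \ {X, a, b}, ω k) * ∏ j, ∏ k ∈ {y j, z j} \ {X, a, b}, ω k ≤
      tailMaj α g X a b c y := by
  have hα0 : 0 < α := by linarith
  have h1 : ∀ k, ω k ≤ 1 := fun k => (hw k).trans (powWt_le_one hα0 k)
  have hP0 : ∀ s : Finset ℕ, 0 ≤ ∏ k ∈ s, ω k := fun s => Finset.prod_nonneg fun k _ => h0 k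
  have hP1 : ∀ s : Finset ℕ, ∏ k ∈ s, ω k ≤ 1 := fun s =>
    Finset.prod_le_one (fun k _ => h0 k) fun k _ => h1 k
  have hz : ∀ j, z j = X + c - y j := fun j => by have := hyz j; omega
  -- the pair is degenerate or contains `a`, but not `b`
  have hspe : ∀ j, ¬ (y j = b ∨ z j = b) → (y j = z j ∨ y j = a ∨ z j = a) →
      ∏ k ∈ {y j, z j} \ {X, a, b}, ω k ≤ speWt α X a c (y j) := by
    clear hdep
    intro j hnb hs
    have e := hyz j
    have e1 := hyX j
    have e2 := hzX j
    have e3 := hyne j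
    have e4 := hzne j
    have hcond : y j = a ∨ y j + a = X + c ∨ 2 * y j = X + c := by omega
    unfold speWt
    rw [if_pos hcond]
    obtain ⟨k, hk, hk2⟩ : ∃ k ∈ ({y j, z j} : Finset ℕ) \ {X, a, b}, X ≤ 2 * k := by
      by_cases hya : y j = a
      · refine ⟨z j, ?_, by omega⟩
        simp only [Finset.mem_sdiff, Finset.mem_insert, Finset.mem_singleton, or_true, true_and]
        omega
      · refine ⟨y j, ?_, by omega⟩
        simp only [Finset.mem_sdiff, Finset.mem_insert, Finset.mem_singleton, true_or, true_and]
        omega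
    exact (prod_le_of_mem h0 h1 hk).trans ((hw k).trans (powWt_le_halfWt hα0.le hX hk2))
  -- the pair avoids `b`
  have hpair : ∀ j, ¬ (y j = b ∨ z j = b) →
      ∏ k ∈ {y j, z j} \ {X, a, b}, ω k ≤ pairWt α X a c (y j) := by
    intro j hnb
    have p1 := mul_nonneg (powWt_nonneg α (y j)) (powWt_nonneg α (X + c - y j))
    by_cases hs : y j = z j ∨ y j = a ∨ z j = a
    · exact (hspe j hnb hs).trans (le_add_of_nonneg_left p1)
    · have e3 := hyne j
      have e4 := hzne j
      have hset : ({y j, z j} : Finset ℕ) \ {X, a, b} = {y j, z j} := by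
        rw [Finset.sdiff_eq_self_iff_disjoint, Finset.disjoint_left]
        simp only [Finset.mem_insert, Finset.mem_singleton]
        omega
      rw [hset, Finset.prod_pair (by tauto), pairWt, ← hz j]
      exact le_add_of_le_of_nonneg
        (mul_le_mul (hw _) (hw _) (h0 _) (powWt_nonneg _ _)) (speWt_nonneg _ _ _ _ _)
  -- the pair contains `b`
  have hhit : ∀ j, (y j = b ∨ z j = b) →
      ∏ k ∈ {y j, z j} \ {X, a, b}, ω k ≤ hitWt α X a b c (y j) := by
    clear hdep
    intro j hjb
    have e := hyz j
    have e1 := hyX j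
    have e2 := hzX j
    have e3 := hyne j
    have e4 := hzne j
    unfold hitWt
    rw [if_pos (by omega)]
    by_cases hpar : X + c = a + b ∨ X + c = 2 * b
    · unfold parInd
      rw [if_pos hpar]
      exact (hP1 _).trans (le_add_of_nonneg_left (powWt_nonneg _ _))
    · have hk : X + c - b ∈ ({y j, z j} : Finset ℕ) \ {X, a, b} := by
        simp only [Finset.mem_sdiff, Finset.mem_insert, Finset.mem_singleton]
        omega
      refine le_add_of_le_of_nonneg ?_ (parInd_nonneg _ _ _ _)
      exact (prod_le_of_mem h0 h1 hk).trans ((hw _).trans (powWt_anti hα0.le hc (by omega)))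
  have hcW : ∏ k ∈ {c} \ {X, a, b}, ω k ≤ powWt α c + excInd X a b c := by
    by_cases hex : c = X ∨ c = a ∨ c = b
    · unfold excInd
      rw [if_pos hex]
      exact (hP1 _).trans (le_add_of_nonneg_left (powWt_nonneg _ _))
    · have hk : c ∈ ({c} : Finset ℕ) \ {X, a, b} := by
        simp only [Finset.mem_sdiff, Finset.mem_insert, Finset.mem_singleton]
        tauto
      exact le_add_of_le_of_nonneg ((prod_le_of_mem h0 h1 hk).trans (hw _))
        (excInd_nonneg _ _ _ _)
  have hfirst : 0 ≤ excInd X a b c * ∏ j, pairWt α X a c (y j) :=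
    mul_nonneg (excInd_nonneg _ _ _ _) (Finset.prod_nonneg fun j _ => pairWt_nonneg _ _ _ _ _)
  have hW0 : 0 ≤ powWt α c + excInd X a b c := add_nonneg (powWt_nonneg _ _) (excInd_nonneg _ _ _ _)
  have hterm0 : ∀ j ∈ (Finset.univ : Finset (Fin g)), 0 ≤ ∏ i, (if i = j then
      speWt α X a c (y i) + hitWt α X a b c (y i) else pairWt α X a c (y i)) := by
    intro j _
    refine Finset.prod_nonneg fun i _ => ?_
    split_ifs
    · exact add_nonneg (speWt_nonneg _ _ _ _ _) (hitWt_nonneg _ _ _ _ _ _)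
    · exact pairWt_nonneg _ _ _ _ _
  have hsecond := mul_nonneg hW0 (Finset.sum_nonneg hterm0)
  have single : ∀ j, (∏ k ∈ {y j, z j} \ {X, a, b}, ω k ≤
      speWt α X a c (y j) + hitWt α X a b c (y j)) → (∀ i, i ≠ j → ¬ (y i = b ∨ z i = b)) →
      (∏ k ∈ {c} \ {X, a, b}, ω k) * ∏ j, ∏ k ∈ {y j, z j} \ {X, a, b}, ω k ≤
      tailMaj α g X a b c y := by
    intro j hj hi
    unfold tailMaj
    refine le_add_of_nonneg_of_le hfirst (mul_le_mul hcW ?_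
      (Finset.prod_nonneg fun j _ => hP0 _) hW0)
    refine le_trans ?_ (Finset.single_le_sum hterm0 (Finset.mem_univ j))
    refine Finset.prod_le_prod (fun i _ => hP0 _) fun i _ => ?_
    split_ifs with hij
    · rw [hij]; exact hj
    · exact hpair i (hi i hij)
  by_cases hB : ∃ j, y j = b ∨ z j = b
  · obtain ⟨j, hj⟩ := hB
    exact single j ((hhit j hj).trans (le_add_of_nonneg_left (speWt_nonneg _ _ _ _ _)))
      fun i hij hib => hij (hb i j hib hj)
  · push Not at hB
    have hB' : ∀ j, ¬ (y j = b ∨ z j = b) := fun j => by have := hB j; tauto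
    by_cases hS : ∃ j, y j = z j ∨ y j = a ∨ z j = a
    · obtain ⟨j, hj⟩ := hS
      exact single j ((hspe j (hB' j) hj).trans
        (le_add_of_nonneg_right (hitWt_nonneg _ _ _ _ _ _))) fun i _ => hB' i
    · have hex : c = X ∨ c = a ∨ c = b := by
        rcases hdep with h | ⟨j, h⟩
        · exact h
        · exact absurd h (by have := hB' j; have : ¬ _ := fun h => hS ⟨j, h⟩; tauto)
      unfold tailMaj
      refine le_add_of_le_of_nonneg (mul_le_mul ?_ ?_
        (Finset.prod_nonneg fun j _ => hP0 _) (excInd_nonneg _ _ _ _)) hsecond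
      · unfold excInd; rw [if_pos hex]; exact hP1 _
      · exact Finset.prod_le_prod (fun i _ => hP0 _) fun i _ => hpair i (hB' i)

lemma triple_cases {X a b r₁ r₂ r₃ : ℕ} (h12 : r₁ ≠ r₂) (h13 : r₁ ≠ r₃) (h23 : r₂ ≠ r₃)
    (h : ({X, a, b} : Finset ℕ) = {r₁, r₂, r₃}) :
    (X = r₁ ∧ a = r₂ ∧ b = r₃) ∨ (X = r₁ ∧ a = r₃ ∧ b = r₂) ∨ (X = r₂ ∧ a = r₁ ∧ b = r₃) ∨
    (X = r₂ ∧ a = r₃ ∧ b = r₁) ∨ (X = r₃ ∧ a = r₁ ∧ b = r₂) ∨ (X = r₃ ∧ a = r₂ ∧ b = r₁) := by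
  have hX : X ∈ ({r₁, r₂, r₃} : Finset ℕ) := by rw [← h]; simp
  have ha : a ∈ ({r₁, r₂, r₃} : Finset ℕ) := by rw [← h]; simp
  have hb : b ∈ ({r₁, r₂, r₃} : Finset ℕ) := by rw [← h]; simp
  have h1 : r₁ ∈ ({X, a, b} : Finset ℕ) := by rw [h]; simp
  have h2 : r₂ ∈ ({X, a, b} : Finset ℕ) := by rw [h]; simp
  have h3 : r₃ ∈ ({X, a, b} : Finset ℕ) := by rw [h]; simp
  simp only [Finset.mem_insert, Finset.mem_singleton] at hX ha hb h1 h2 h3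
  clear h
  rcases hX with rfl | rfl | rfl <;> rcases ha with rfl | rfl | rfl <;>
    rcases hb with rfl | rfl | rfl <;> first | (simp; done) | (exfalso; omega)

lemma index_cases {g : ℕ} (i : Fin (2 * g + 4)) :
    i = ⟨0, by omega⟩ ∨ i = ⟨1, by omega⟩ ∨ i = ⟨2, by omega⟩ ∨ i = ⟨3, by omega⟩ ∨
    ∃ k : Fin g, i = ⟨2 * k + 4, by omega⟩ ∨ i = ⟨2 * k + 5, by omega⟩ := by
  obtain ⟨i, hi⟩ := i
  simp only [Fin.mk.injEq]
  by_cases h : i < 4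
  · omega
  · have := Nat.div_add_mod i 2
    exact Or.inr (Or.inr (Or.inr (Or.inr ⟨⟨(i - 4) / 2, by omega⟩, by simp only []; omega⟩)))

/-- The first elements of the pairs other than `{x₁, x₄}` in a tuple. -/
def fstPart (g : ℕ) (x : Fin (2 * g + 4) → ℕ) (j : Fin g) : ℕ := x ⟨2 * j + 4, by omega⟩

/-- The second elements of the pairs other than `{x₁, x₄}` in a tuple. -/
def sndPart (g : ℕ) (x : Fin (2 * g + 4) → ℕ) (j : Fin g) : ℕ := x ⟨2 * j + 5, by omega⟩

lemma pairOf_zero (g : ℕ) (x : Fin (2 * g + 4) → ℕ) :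
    pairOf g x 0 = {x ⟨0, by omega⟩, x ⟨3, by omega⟩} := by
  unfold pairOf; simp

lemma pairOf_succ (g : ℕ) (x : Fin (2 * g + 4) → ℕ) (j : Fin g) :
    pairOf g x (j + 1) = {fstPart g x j, sndPart g x j} := by
  unfold pairOf fstPart sndPart
  rw [if_neg (by omega), dif_pos (by omega)]
  rfl

lemma prod_imgF_eq {ω : ℕ → ℝ} {g X a b c : ℕ} {x : Fin (2 * g + 4) → ℕ}
    (h0 : x ⟨0, by omega⟩ = X) (h1 : x ⟨1, by omega⟩ = a) (h2 : x ⟨2, by omega⟩ = b)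
    (h3 : x ⟨3, by omega⟩ = c)
    (hcy : ∀ j, fstPart g x j ≠ c) (hcz : ∀ j, sndPart g x j ≠ c)
    (hd : ∀ i j, i ≠ j → Disjoint ({fstPart g x i, sndPart g x i} : Finset ℕ)
      {fstPart g x j, sndPart g x j}) :
    ∏ k ∈ imgF x, ω k = (∏ k ∈ {X, a, b}, ω k) * ((∏ k ∈ {c} \ {X, a, b}, ω k) *
      ∏ j, ∏ k ∈ {fstPart g x j, sndPart g x j} \ {X, a, b}, ω k) := by
  have himg : imgF x = {X, a, b} ∪ ({c} \ {X, a, b} ∪ Finset.univ.biUnion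
      fun j => {fstPart g x j, sndPart g x j} \ {X, a, b}) := by
    ext k
    simp only [imgF, Finset.mem_image, Finset.mem_univ, true_and, Finset.mem_union,
      Finset.mem_sdiff, Finset.mem_biUnion, Finset.mem_insert, Finset.mem_singleton]
    constructor
    · rintro ⟨i, rfl⟩
      by_cases hA : x i = X ∨ x i = a ∨ x i = b
      · exact Or.inl hA
      · right
        rcases index_cases i with rfl | rfl | rfl | rfl | ⟨j, rfl | rfl⟩
        · exact absurd (Or.inl h0) hA
        · exact absurd (Or.inr (Or.inl h1)) hA
        · exact absurd (Or.inr (Or.inr h2)) hA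
        · exact Or.inl ⟨h3, hA⟩
        · exact Or.inr ⟨j, Or.inl rfl, hA⟩
        · exact Or.inr ⟨j, Or.inr rfl, hA⟩
    · rintro ((h | h | h) | ⟨h, -⟩ | ⟨j, h | h, -⟩)
      · exact ⟨_, h0.trans h.symm⟩
      · exact ⟨_, h1.trans h.symm⟩
      · exact ⟨_, h2.trans h.symm⟩
      · exact ⟨_, h3.trans h.symm⟩
      · exact ⟨_, h.symm⟩
      · exact ⟨_, h.symm⟩
  rw [himg, Finset.prod_union, Finset.prod_union, Finset.prod_biUnion]
  · intro i _ j _ hij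
    exact (hd i j hij).mono Finset.sdiff_subset Finset.sdiff_subset
  · rw [Finset.disjoint_left]
    intro k hk
    simp only [Finset.mem_sdiff, Finset.mem_singleton, Finset.mem_biUnion, Finset.mem_univ,
      true_and, Finset.mem_insert, not_exists] at hk ⊢
    rintro j ⟨h | h, -⟩
    · exact hcy j (h.symm.trans hk.1)
    · exact hcz j (h.symm.trans hk.1)
  · rw [Finset.disjoint_left]
    intro k hk
    simp only [Finset.mem_union, Finset.mem_sdiff, Finset.mem_biUnion]
    rintro (h | ⟨j, -, h⟩)
    · exact h.2 hk
    · exact h.2 hk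

lemma prod_imgF_le {α lam : ℝ} (hα : 1 / 2 < α) {ω : ℕ → ℝ} (h0 : ∀ k, 0 ≤ ω k)
    (hw : ∀ k, ω k ≤ powWt α k) {g M : ℕ} {s : ℕ → Fin 3 → ZMod M} {n : ℕ}
    {x : Fin (2 * g + 4) → ℕ} (hx : x ∈ TnDep g M lam s n) {X a b : ℕ}
    (hX : x ⟨0, by omega⟩ = X) (ha : x ⟨1, by omega⟩ = a) (hb : x ⟨2, by omega⟩ = b)
    (hXa : X ≠ a) (hXb : X ≠ b) (hab : a ≠ b)
    (hsmall : (a ≤ X → 2 * a ≤ X) ∨ (b ≤ X → 2 * b ≤ X)) :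
    ∏ k ∈ imgF x, ω k ≤ (∏ k ∈ {X, a, b}, ω k) *
      (tailMaj α g X a b (x ⟨3, by omega⟩) (fstPart g x) +
        tailMaj α g X b a (x ⟨3, by omega⟩) (fstPart g x)) := by
  obtain ⟨⟨hpos, -, hsum, hle, -, hpairs⟩, hinj⟩ := hx
  obtain ⟨c, hxc⟩ : ∃ c, x ⟨3, by omega⟩ = c := ⟨_, rfl⟩
  rw [hxc]
  have hyz : ∀ j, fstPart g x j + sndPart g x j = X + c := by
    intro j
    have := hsum (j + 2) (by omega) (by omega)
    rw [hX, hxc] at this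
    exact this.symm
  have hyX : ∀ j, fstPart g x j ≤ X := by
    intro j; rw [← hX]; exact hle _ (by simp only []; omega)
  have hzX : ∀ j, sndPart g x j ≤ X := by
    intro j; rw [← hX]; exact hle _ (by simp only []; omega)
  have hX1 : 1 ≤ X := by rw [← hX]; exact hpos _
  have hc1 : 1 ≤ c := by rw [← hxc]; exact hpos _
  have hp0 : ∀ j : Fin g, ({fstPart g x j, sndPart g x j} : Finset ℕ) ≠ {X, c} := by
    intro j
    have := hpairs (j + 1) 0 (by omega) (by omega) (by omega)
    rwa [pairOf_zero, pairOf_succ, hX, hxc] at this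
  have hp : ∀ i j : Fin g, i ≠ j → ({fstPart g x i, sndPart g x i} : Finset ℕ) ≠
      {fstPart g x j, sndPart g x j} := by
    intro i j hij
    have := hpairs (i + 1) (j + 1) (by omega) (by omega)
      (fun h => hij (Fin.ext (by omega)))
    rwa [pairOf_succ, pairOf_succ] at this
  have hyne : ∀ j, fstPart g x j ≠ X := fun j h => hp0 j (by
    rw [h, show sndPart g x j = c by have := hyz j; omega])
  have hzne : ∀ j, sndPart g x j ≠ X := fun j h => hp0 j (by
    rw [h, show fstPart g x j = c by have := hyz j; omega, Finset.pair_comm])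
  have hync : ∀ j, fstPart g x j ≠ c := fun j h => hzne j (by have := hyz j; omega)
  have hznc : ∀ j, sndPart g x j ≠ c := fun j h => hyne j (by have := hyz j; omega)
  have hyy : ∀ i j, fstPart g x i = fstPart g x j → i = j := fun i j h => by
    by_contra hij
    exact hp i j hij (by
      rw [h, show sndPart g x i = sndPart g x j by have := hyz i; have := hyz j; omega])
  have hzz : ∀ i j, sndPart g x i = sndPart g x j → i = j := fun i j h =>
    hyy i j (by have := hyz i; have := hyz j; omega)
  have hyzne : ∀ i j, fstPart g x i = sndPart g x j → i = j := fun i j h => by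
    by_contra hij
    exact hp i j hij (by
      rw [h, show sndPart g x i = fstPart g x j by have := hyz i; have := hyz j; omega,
        Finset.pair_comm])
  have hd : ∀ i j, i ≠ j → Disjoint ({fstPart g x i, sndPart g x i} : Finset ℕ)
      {fstPart g x j, sndPart g x j} := by
    intro i j hij
    rw [Finset.disjoint_left]
    intro k hk hk'
    simp only [Finset.mem_insert, Finset.mem_singleton] at hk hk'
    rcases hk with rfl | rfl <;> rcases hk' with h | h
    · exact hij (hyy _ _ h)
    · exact hij (hyzne _ _ h)
    · exact hij (hyzne _ _ h.symm).symm
    · exact hij (hzz _ _ h)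
  have hmem : ∀ d i j, (fstPart g x i = d ∨ sndPart g x i = d) →
      (fstPart g x j = d ∨ sndPart g x j = d) → i = j := by
    intro d i j hi hj
    by_contra hij
    refine Finset.disjoint_left.1 (hd i j hij) (?_ : d ∈ _) ?_
    · rw [Finset.mem_insert, Finset.mem_singleton]
      exact hi.imp Eq.symm Eq.symm
    · rw [Finset.mem_insert, Finset.mem_singleton]
      exact hj.imp Eq.symm Eq.symm
  have hdep : (c = X ∨ c = a ∨ c = b) ∨ ∃ j, fstPart g x j = sndPart g x j ∨
      fstPart g x j = a ∨ sndPart g x j = a ∨ fstPart g x j = b ∨ sndPart g x j = b := by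
    by_contra hcon
    push Not at hcon
    obtain ⟨⟨c1, c2, c3⟩, hj⟩ := hcon
    refine hinj fun i i' h => ?_
    have fy : ∀ k : Fin g, x ⟨2 * k + 4, by omega⟩ = fstPart g x k := fun k => rfl
    have fz : ∀ k : Fin g, x ⟨2 * k + 5, by omega⟩ = sndPart g x k := fun k => rfl
    rcases index_cases i with rfl | rfl | rfl | rfl | ⟨k, rfl | rfl⟩ <;>
    rcases index_cases i' with rfl | rfl | rfl | rfl | ⟨k', rfl | rfl⟩ <;>
    first
    | rfl
    | (simp only [hX, ha, hb, hxc, fy, fz] at h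
       first
       | omega
       | (have := hj k'; have := hyne k'; have := hzne k'; have := hync k'
          have := hznc k'; omega)
       | (have := hj k; have := hyne k; have := hzne k; have := hync k
          have := hznc k; omega)
       | (have := hyy k k' h; subst this; rfl)
       | (have := hzz k k' h; subst this; rfl)
       | (have := hyzne k k' h; subst this; exact absurd h (hj _).1)
       | (have := hyzne k' k h.symm; subst this; exact absurd h.symm (hj _).1))
  rw [prod_imgF_eq hX ha hb hxc hync hznc hd]
  refine mul_le_mul_of_nonneg_left ?_ (Finset.prod_nonneg fun k _ => h0 k)
  rcases hsmall with hs | hs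
  · exact le_add_of_le_of_nonneg (tail_prod_le hα h0 hw hX1 hc1 hyX hzX hyz hyne hzne (hmem b) hs
      hdep) (tailMaj_nonneg _ _ _ _ _ _ _)
  · rw [Finset.pair_comm a b]
    refine le_add_of_nonneg_of_le (tailMaj_nonneg _ _ _ _ _ _ _) (tail_prod_le hα h0 hw hX1 hc1
      hyX hzX hyz hyne hzne (hmem a) hs ?_)
    rcases hdep with h | ⟨j, h⟩
    · left; tauto
    · exact Or.inr ⟨j, by tauto⟩

lemma Rtrip.perm {g M : ℕ} {lam : ℝ} {CM : Set (ZMod M)} {s : ℕ → Fin 3 → ZMod M}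
    (hs : GoodS M CM s) {n X a b : ℕ} (h : ({X, a, b} : Finset ℕ) ∈ Rn g M lam s n) :
    ∃ r₁ r₂ r₃, Rtrip g M lam s n r₁ r₂ r₃ ∧ (r₁ ≠ r₂ ∧ r₁ ≠ r₃ ∧ r₂ ≠ r₃) ∧
      ({X, a, b} : Finset ℕ) = {r₁, r₂, r₃} ∧
      ((X = r₁ ∧ a = r₂ ∧ b = r₃) ∨ (X = r₁ ∧ a = r₃ ∧ b = r₂) ∨
      (X = r₂ ∧ a = r₁ ∧ b = r₃) ∨ (X = r₂ ∧ a = r₃ ∧ b = r₁) ∨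
      (X = r₃ ∧ a = r₁ ∧ b = r₂) ∨ (X = r₃ ∧ a = r₂ ∧ b = r₁)) := by
  obtain ⟨r₁, r₂, r₃, he, hR⟩ := h
  obtain ⟨-, s01, s02, s12, -⟩ := hs n
  have hR' := hR
  obtain ⟨-, -, -, -, -, -, -, -, -, -, m1, m2, m3⟩ := hR'
  have h12 : r₁ ≠ r₂ := by rintro rfl; exact s01 (m1.symm.trans m2)
  have h13 : r₁ ≠ r₃ := by rintro rfl; exact s02 (m1.symm.trans m3)
  have h23 : r₂ ≠ r₃ := by rintro rfl; exact s12 (m2.symm.trans m3)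
  exact ⟨r₁, r₂, r₃, hR, ⟨h12, h13, h23⟩, he, triple_cases h12 h13 h23 he⟩

open Classical in
/-- The ordered triples whose underlying set lies in `Rn`. -/
def triples (g M : ℕ) (lam : ℝ) (s : ℕ → Fin 3 → ZMod M) (n : ℕ) : Finset (ℕ × ℕ × ℕ) :=
  (Finset.range (n + 1) ×ˢ Finset.range (n + 1) ×ˢ Finset.range (n + 1)).filter
    fun t => ({t.1, t.2.1, t.2.2} : Finset ℕ) ∈ Rn g M lam s n

lemma mem_triples {g M : ℕ} {lam : ℝ} {s : ℕ → Fin 3 → ZMod M} {n : ℕ} {t : ℕ × ℕ × ℕ} :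
    t ∈ triples g M lam s n ↔ (t.1 ≤ n ∧ t.2.1 ≤ n ∧ t.2.2 ≤ n) ∧
      ({t.1, t.2.1, t.2.2} : Finset ℕ) ∈ Rn g M lam s n := by
  classical
  simp only [triples, Finset.mem_filter, Finset.mem_product, Finset.mem_range, Nat.lt_succ_iff]

lemma card_triples_le {g M : ℕ} {lam : ℝ} {CM : Set (ZMod M)} {s : ℕ → Fin 3 → ZMod M}
    (hs : GoodS M CM s) {n : ℕ} (hG : 0 ≤ glam g lam n) :
    ((triples g M lam s n).card : ℝ) ≤ 3 * (glam g lam n * n) := by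
  set B : Finset (ℕ × ℕ) := Finset.Icc 1 ⌊glam g lam n⌋₊ ×ˢ Finset.Icc 1 n with hB
  have hsub : triples g M lam s n ⊆
      B.image (fun p => (p.1, p.2, n - p.1 - p.2)) ∪
      (B.image (fun p => (p.2, p.1, n - p.1 - p.2)) ∪
      B.image (fun p => (p.2, n - p.1 - p.2, p.1))) := by
    rintro ⟨X, a, b⟩ ht
    rw [mem_triples] at ht
    obtain ⟨r₁, r₂, r₃, hR, -, -, hc⟩ := Rtrip.perm hs ht.2
    obtain ⟨p1, p2, p3, hsum, -, hle, -, -, -, -, -⟩ := hR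
    have hle' : r₁ ≤ ⌊glam g lam n⌋₊ := Nat.le_floor hle
    have m2 : (r₁, r₂) ∈ B := by
      rw [hB, Finset.mem_product, Finset.mem_Icc, Finset.mem_Icc]
      simp only []; omega
    have m3 : (r₁, r₃) ∈ B := by
      rw [hB, Finset.mem_product, Finset.mem_Icc, Finset.mem_Icc]
      simp only []; omega
    have e2 : n - r₁ - r₃ = r₂ := by omega
    have e3 : n - r₁ - r₂ = r₃ := by omega
    simp only [Finset.mem_union, Finset.mem_image]
    rcases hc with ⟨rfl, rfl, rfl⟩ | ⟨rfl, rfl, rfl⟩ | ⟨rfl, rfl, rfl⟩ | ⟨rfl, rfl, rfl⟩ |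
      ⟨rfl, rfl, rfl⟩ | ⟨rfl, rfl, rfl⟩
    · exact Or.inl ⟨_, m2, by simp only [e3]⟩
    · exact Or.inl ⟨_, m3, by simp only [e2]⟩
    · exact Or.inr (Or.inl ⟨_, m2, by simp only [e3]⟩)
    · exact Or.inr (Or.inr ⟨_, m2, by simp only [e3]⟩)
    · exact Or.inr (Or.inl ⟨_, m3, by simp only [e2]⟩)
    · exact Or.inr (Or.inr ⟨_, m3, by simp only [e2]⟩)
  have hcard : (triples g M lam s n).card ≤ 3 * B.card := by
    refine (Finset.card_le_card hsub).trans ((Finset.card_union_le _ _).trans ?_)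
    have h1 := Finset.card_image_le (s := B) (f := fun p => (p.1, p.2, n - p.1 - p.2))
    have h2 := Finset.card_union_le (B.image (fun p => (p.2, p.1, n - p.1 - p.2)))
      (B.image (fun p => (p.2, n - p.1 - p.2, p.1)))
    have h3 := Finset.card_image_le (s := B) (f := fun p => (p.2, p.1, n - p.1 - p.2))
    have h4 := Finset.card_image_le (s := B) (f := fun p => (p.2, n - p.1 - p.2, p.1))
    omega
  have hBc : B.card = ⌊glam g lam n⌋₊ * n := by
    rw [hB, Finset.card_product]; simp
  rw [hBc] at hcard
  calc ((triples g M lam s n).card : ℝ) ≤ ((3 * (⌊glam g lam n⌋₊ * n) : ℕ) : ℝ) := by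
        exact_mod_cast hcard
    _ = 3 * (⌊glam g lam n⌋₊ * n) := by push_cast; ring
    _ ≤ _ := by
      have := Nat.floor_le hG
      gcongr

lemma sum_triples_le {α : ℝ} (hα : 0 < α) {ω : ℕ → ℝ} (h0 : ∀ k, 0 ≤ ω k)
    (hw : ∀ k, ω k ≤ powWt α k) {g M : ℕ} {lam : ℝ} {CM : Set (ZMod M)}
    {s : ℕ → Fin 3 → ZMod M} (hs : GoodS M CM s) {n : ℕ} (hn : 1 ≤ n)
    (hG : 0 < glam g lam n) :
    ∑ t ∈ triples g M lam s n, ∏ k ∈ {t.1, t.2.1, t.2.2}, ω k ≤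
      3 * 2 ^ α * (4 ^ α) ^ 2 * glam g lam n ^ (1 - α) * (n : ℝ) ^ (1 - 2 * α) := by
  have hn0 : (0 : ℝ) < n := by exact_mod_cast hn
  set G := glam g lam n with hGdef
  have hterm : ∀ t ∈ triples g M lam s n, ∏ k ∈ {t.1, t.2.1, t.2.2}, ω k ≤
      (G / 2) ^ (-α) * (((n : ℝ) / 4) ^ (-α) * ((n : ℝ) / 4) ^ (-α)) := by
    rintro ⟨X, a, b⟩ ht
    rw [mem_triples] at ht
    obtain ⟨r₁, r₂, r₃, hR, ⟨h12, h13, h23⟩, he, -⟩ := Rtrip.perm hs ht.2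
    obtain ⟨p1, p2, p3, -, l1, -, l2, -, l3, -, -⟩ := hR
    simp only [] at he ⊢
    rw [he, Finset.prod_insert (by simp [h12, h13]), Finset.prod_pair h23]
    have b1 : ω r₁ ≤ (G / 2) ^ (-α) := (hw _).trans
      (Real.rpow_le_rpow_of_nonpos (by positivity) l1 (by linarith))
    have b2 : ω r₂ ≤ ((n : ℝ) / 4) ^ (-α) := (hw _).trans
      (Real.rpow_le_rpow_of_nonpos (by positivity) l2 (by linarith))
    have b3 : ω r₃ ≤ ((n : ℝ) / 4) ^ (-α) := (hw _).trans
      (Real.rpow_le_rpow_of_nonpos (by positivity) l3 (by linarith))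
    have := h0 r₁
    have := h0 r₂
    have := h0 r₃
    gcongr
  refine (Finset.sum_le_sum hterm).trans ?_
  rw [Finset.sum_const, nsmul_eq_mul]
  have hK : 0 ≤ (G / 2) ^ (-α) * (((n : ℝ) / 4) ^ (-α) * ((n : ℝ) / 4) ^ (-α)) := by positivity
  refine (mul_le_mul_of_nonneg_right (card_triples_le hs hG.le) hK).trans (le_of_eq ?_)
  rw [← hGdef, Real.div_rpow hG.le (by norm_num), Real.div_rpow hn0.le (by norm_num),
    Real.rpow_neg (by norm_num : (0 : ℝ) ≤ 2), Real.rpow_neg (by norm_num : (0 : ℝ) ≤ 4)]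
  have e1 : G ^ (1 - α) = G * G ^ (-α) := by
    nth_rewrite 2 [← Real.rpow_one G]
    rw [← Real.rpow_add hG]; congr 1
  have e2 : (n : ℝ) ^ (1 - 2 * α) = n * ((n : ℝ) ^ (-α) * (n : ℝ) ^ (-α)) := by
    nth_rewrite 2 [← Real.rpow_one (n : ℝ)]
    rw [← Real.rpow_add hn0, ← Real.rpow_add hn0]; congr 1; ring
  rw [e1, e2]
  field_simp

lemma Tn.le {g M : ℕ} {lam : ℝ} {s : ℕ → Fin 3 → ZMod M} {n : ℕ}
    {x : Fin (2 * g + 4) → ℕ} (hx : x ∈ Tn g M lam s n) (i : Fin (2 * g + 4)) : x i ≤ n := by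
  obtain ⟨-, ⟨r₁, r₂, r₃, he, -, -, -, hsum, -⟩, -, hle, -⟩ := hx
  have hmem : ∀ k ∈ firstThree g x, k ≤ n := by
    intro k hk
    rw [he] at hk
    simp only [Finset.mem_insert, Finset.mem_singleton] at hk
    omega
  have h0 : x ⟨0, by omega⟩ ≤ n := hmem _ (by simp [firstThree])
  rcases index_cases i with rfl | rfl | rfl | rfl | ⟨k, rfl | rfl⟩
  · exact h0
  · exact hmem _ (by simp [firstThree])
  · exact hmem _ (by simp [firstThree])
  all_goals exact (hle _ (by simp only []; omega)).trans h0

lemma TnDep_finite (g M : ℕ) (lam : ℝ) (s : ℕ → Fin 3 → ZMod M) (n : ℕ) :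
    (TnDep g M lam s n).Finite := by
  refine (Finset.finite_toSet (Fintype.piFinset fun _ => Finset.range (n + 1))).subset ?_
  intro x hx
  rw [Finset.mem_coe, Fintype.mem_piFinset]
  intro i
  have := Tn.le hx.1 i
  rw [Finset.mem_range]; omega

/-- A tuple split into its leading triple, its fourth entry and the first parts of its pairs. -/
def splitTuple (g : ℕ) (x : Fin (2 * g + 4) → ℕ) : (_ : ℕ × ℕ × ℕ) × ℕ × (Fin g → ℕ) :=
  ⟨(x ⟨0, by omega⟩, x ⟨1, by omega⟩, x ⟨2, by omega⟩), x ⟨3, by omega⟩, fstPart g x⟩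

lemma fst_add_sndPart {g M : ℕ} {lam : ℝ} {s : ℕ → Fin 3 → ZMod M} {n : ℕ}
    {x : Fin (2 * g + 4) → ℕ} (hx : x ∈ Tn g M lam s n) (j : Fin g) :
    fstPart g x j + sndPart g x j = x ⟨0, by omega⟩ + x ⟨3, by omega⟩ :=
  (hx.2.2.1 (j + 2) (by omega) (by omega)).symm

lemma splitTuple_injOn (g M : ℕ) (lam : ℝ) (s : ℕ → Fin 3 → ZMod M) (n : ℕ) :
    Set.InjOn (splitTuple g) (Tn g M lam s n) := by
  intro x hx x' hx' h
  simp only [splitTuple, Sigma.mk.injEq, heq_eq_eq, Prod.mk.injEq] at h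
  obtain ⟨⟨h0, h1, h2⟩, h3, hy⟩ := h
  funext i
  rcases index_cases i with rfl | rfl | rfl | rfl | ⟨k, rfl | rfl⟩
  · exact h0
  · exact h1
  · exact h2
  · exact h3
  · exact congrFun hy k
  · have e := fst_add_sndPart hx k
    have e' := fst_add_sndPart hx' k
    rw [h0, h3, congrFun hy k] at e
    change sndPart g x k = sndPart g x' k
    omega

lemma sum_TnDep_le {α : ℝ} (h0 : 1 / 2 < α) (h1 : α < 1) {ω : ℕ → ℝ} (hω : ∀ k, 0 ≤ ω k)
    (hw : ∀ k, ω k ≤ powWt α k) {g M : ℕ} {lam : ℝ} {CM : Set (ZMod M)}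
    {s : ℕ → Fin 3 → ZMod M} (hs : GoodS M CM s) {n : ℕ}
    (hG : 0 < glam g lam n) (hGn : 8 * glam g lam n < n) {C : ℝ} (hC : 0 < C)
    (htail : ∀ X a b : ℕ, 1 ≤ X →
      ∑ c ∈ Finset.Icc 1 X, ∑ y ∈ Fintype.piFinset (fun _ : Fin g => Finset.Icc 1 X),
        tailMaj α g X a b c y ≤ C * (X : ℝ) ^ (1 - 2 * α)) :
    ∑ x ∈ (TnDep_finite g M lam s n).toFinset, ∏ k ∈ imgF x, ω k ≤
      2 * C * (glam g lam n / 2) ^ (1 - 2 * α) *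
        ∑ t ∈ triples g M lam s n, ∏ k ∈ {t.1, t.2.1, t.2.2}, ω k := by
  set big : Finset ((_ : ℕ × ℕ × ℕ) × ℕ × (Fin g → ℕ)) := (triples g M lam s n).sigma fun t =>
    Finset.Icc 1 t.1 ×ˢ Fintype.piFinset (fun _ : Fin g => Finset.Icc 1 t.1) with hbig
  set H : (_ : ℕ × ℕ × ℕ) × ℕ × (Fin g → ℕ) → ℝ := fun p =>
    (∏ k ∈ {p.1.1, p.1.2.1, p.1.2.2}, ω k) *
      (tailMaj α g p.1.1 p.1.2.1 p.1.2.2 p.2.1 p.2.2 +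
        tailMaj α g p.1.1 p.1.2.2 p.1.2.1 p.2.1 p.2.2) with hH
  have hH0 : ∀ p, 0 ≤ H p := fun p => mul_nonneg (Finset.prod_nonneg fun k _ => hω k)
    (add_nonneg (tailMaj_nonneg _ _ _ _ _ _ _) (tailMaj_nonneg _ _ _ _ _ _ _))
  have hle : ∀ x ∈ (TnDep_finite g M lam s n).toFinset,
      ∏ k ∈ imgF x, ω k ≤ H (splitTuple g x) := by
    intro x hx
    rw [Set.Finite.mem_toFinset] at hx
    have hR : ({x ⟨0, by omega⟩, x ⟨1, by omega⟩, x ⟨2, by omega⟩} : Finset ℕ) ∈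
      Rn g M lam s n := hx.1.2.1
    obtain ⟨r₁, r₂, r₃, hr, hne, -, hc⟩ := Rtrip.perm hs hR
    obtain ⟨p1, p2, p3, -, -, l1, l2, -, l3, -, -⟩ := hr
    have q2 : 2 * r₁ < r₂ := by
      have : (2 * r₁ : ℝ) < r₂ := by linarith
      exact_mod_cast this
    have q3 : 2 * r₁ < r₃ := by
      have : (2 * r₁ : ℝ) < r₃ := by linarith
      exact_mod_cast this
    clear hR
    exact prod_imgF_le h0 hω hw hx (X := x ⟨0, by omega⟩) (a := x ⟨1, by omega⟩)
      (b := x ⟨2, by omega⟩) rfl rfl rfl (by omega) (by omega) (by omega) (by omega)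
  have hinj : Set.InjOn (splitTuple g) ((TnDep_finite g M lam s n).toFinset : Set _) := by
    refine (splitTuple_injOn g M lam s n).mono ?_
    intro x hx
    rw [Set.Finite.coe_toFinset] at hx
    exact hx.1
  have hsub : (TnDep_finite g M lam s n).toFinset.image (splitTuple g) ⊆ big := by
    intro p hp
    rw [Finset.mem_image] at hp
    obtain ⟨x, hx, rfl⟩ := hp
    rw [Set.Finite.mem_toFinset] at hx
    have hl := Tn.le hx.1
    have hpos := hx.1.1
    have hX := hx.1.2.2.2.1
    rw [hbig, Finset.mem_sigma, mem_triples, Finset.mem_product, Fintype.mem_piFinset]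
    simp only [Finset.mem_Icc, splitTuple]
    exact ⟨⟨⟨hl _, hl _, hl _⟩, hx.1.2.1⟩, ⟨hpos _, hX _ (by simp only []; omega)⟩,
      fun j => ⟨hpos _, hX _ (by simp only []; omega)⟩⟩
  calc _ ≤ ∑ x ∈ (TnDep_finite g M lam s n).toFinset, H (splitTuple g x) := Finset.sum_le_sum hle
    _ = ∑ p ∈ (TnDep_finite g M lam s n).toFinset.image (splitTuple g), H p :=
      (Finset.sum_image hinj).symm
    _ ≤ ∑ p ∈ big, H p := Finset.sum_le_sum_of_subset_of_nonneg hsub fun p _ _ => hH0 p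
    _ = ∑ t ∈ triples g M lam s n, (∏ k ∈ {t.1, t.2.1, t.2.2}, ω k) *
        (∑ c ∈ Finset.Icc 1 t.1, ∑ y ∈ Fintype.piFinset (fun _ : Fin g => Finset.Icc 1 t.1),
          tailMaj α g t.1 t.2.1 t.2.2 c y +
        ∑ c ∈ Finset.Icc 1 t.1, ∑ y ∈ Fintype.piFinset (fun _ : Fin g => Finset.Icc 1 t.1),
          tailMaj α g t.1 t.2.2 t.2.1 c y) := by
      rw [hbig, Finset.sum_sigma]
      refine Finset.sum_congr rfl fun t _ => ?_
      simp only [hH]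
      rw [← Finset.mul_sum, Finset.sum_add_distrib, Finset.sum_product, Finset.sum_product]
    _ ≤ ∑ t ∈ triples g M lam s n, (∏ k ∈ {t.1, t.2.1, t.2.2}, ω k) *
        (2 * C * (glam g lam n / 2) ^ (1 - 2 * α)) := by
      refine Finset.sum_le_sum fun t ht => ?_
      refine mul_le_mul_of_nonneg_left ?_ (Finset.prod_nonneg fun k _ => hω k)
      rw [mem_triples] at ht
      obtain ⟨r₁, r₂, r₃, hr, -, -, hc⟩ := Rtrip.perm hs ht.2
      obtain ⟨p1, p2, p3, -, l0, -, l2, -, l3, -, -⟩ := hr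
      have hX1 : 1 ≤ t.1 := by clear ht; omega
      have hX2 : glam g lam n / 2 ≤ (t.1 : ℝ) := by
        have : t.1 = r₁ ∨ t.1 = r₂ ∨ t.1 = r₃ := by clear ht; omega
        rcases this with h | h | h <;> rw [h] <;> linarith
      have hXp : (t.1 : ℝ) ^ (1 - 2 * α) ≤ (glam g lam n / 2) ^ (1 - 2 * α) :=
        Real.rpow_le_rpow_of_nonpos (by linarith) hX2 (by linarith)
      have t1 := htail t.1 t.2.1 t.2.2 hX1
      have t2 := htail t.1 t.2.2 t.2.1 hX1
      nlinarith
    _ = _ := by rw [← Finset.sum_mul, mul_comm]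

lemma eventually_glam (g : ℕ) (hg : 2 ≤ g) {lam : ℝ} (hlam : 1 < lam) :
    ∀ᶠ n : ℕ in Filter.atTop, 1 ≤ n ∧ 1 ≤ Real.log n ∧
      (n : ℝ) ^ ((1 : ℝ) / (g : ℝ)) ≤ glam g lam n ∧ 8 * glam g lam n < n := by
  have hg' : (2 : ℝ) ≤ g := by exact_mod_cast hg
  have hα : 0 < 1 - alph g := by
    unfold alph
    rw [sub_pos, div_lt_one (by positivity)]; linarith
  set K : ℝ := lam ^ ((2 * (g : ℝ) + 5) / (1 - alph g)) with hK
  have hK1 : 1 ≤ K := Real.one_le_rpow hlam.le (by positivity)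
  have hlog : ∀ᶠ x : ℝ in Filter.atTop, 1 ≤ Real.log x :=
    Real.tendsto_log_atTop.eventually_ge_atTop 1
  have hlit := (isLittleO_log_rpow_rpow_atTop ((1 : ℝ) / (1 - alph g))
    (by norm_num : (0 : ℝ) < 1 / 2)).bound (show 0 < 1 / (16 * K) by positivity)
  have hR : ∀ᶠ x : ℝ in Filter.atTop, 1 ≤ x ∧ 1 ≤ Real.log x ∧
      Real.log x ^ ((1 : ℝ) / (1 - alph g)) ≤ 1 / (16 * K) * x ^ ((1 : ℝ) / 2) := by
    filter_upwards [hlog, hlit, Filter.eventually_ge_atTop 1] with x hx1 hx2 hx3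
    refine ⟨hx3, hx1, ?_⟩
    rwa [Real.norm_of_nonneg (by positivity), Real.norm_of_nonneg (by positivity)] at hx2
  filter_upwards [tendsto_natCast_atTop_atTop.eventually hR] with n hn
  obtain ⟨n1, nl, nb⟩ := hn
  have hn0 : (0 : ℝ) < n := by linarith
  refine ⟨by exact_mod_cast n1, nl, ?_, ?_⟩
  · unfold glam
    have hl : 1 ≤ Real.log n ^ ((1 : ℝ) / (1 - alph g)) := Real.one_le_rpow nl (by positivity)
    have hp : 0 ≤ (n : ℝ) ^ ((1 : ℝ) / (g : ℝ)) := by positivity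
    rw [← hK]
    have : (n : ℝ) ^ ((1 : ℝ) / (g : ℝ)) ≤ K * (n : ℝ) ^ ((1 : ℝ) / (g : ℝ)) :=
      le_mul_of_one_le_left hp hK1
    exact this.trans (le_mul_of_one_le_right (by positivity) hl)
  · unfold glam
    rw [← hK]
    have hp : (n : ℝ) ^ ((1 : ℝ) / (g : ℝ)) ≤ (n : ℝ) ^ ((1 : ℝ) / 2) :=
      Real.rpow_le_rpow_of_exponent_le n1 (by gcongr)
    have hsq : (n : ℝ) ^ ((1 : ℝ) / 2) * (n : ℝ) ^ ((1 : ℝ) / 2) = n := by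
      rw [← Real.rpow_add hn0]; norm_num
    calc 8 * (K * (n : ℝ) ^ ((1 : ℝ) / (g : ℝ)) * Real.log n ^ ((1 : ℝ) / (1 - alph g)))
        ≤ 8 * (K * (n : ℝ) ^ ((1 : ℝ) / 2) * (1 / (16 * K) * (n : ℝ) ^ ((1 : ℝ) / 2))) := by
          gcongr
      _ = (n : ℝ) ^ ((1 : ℝ) / 2) * (n : ℝ) ^ ((1 : ℝ) / 2) / 2 := by
          generalize (n : ℝ) ^ ((1 : ℝ) / 2) = p
          field_simp; ring
      _ = (n : ℝ) / 2 := by rw [hsq]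
      _ < n := by linarith

lemma glam_rpow_mul (g : ℕ) (hg : 2 ≤ g) {lam : ℝ} (hlam : 1 < lam) {n : ℕ} (hn : 1 ≤ n)
    (hlog : 0 ≤ Real.log n) :
    glam g lam n ^ (1 - alph g) * (n : ℝ) ^ (1 - 2 * alph g) =
      lam ^ (2 * (g : ℝ) + 5) * Real.log n := by
  have hg' : (2 : ℝ) ≤ g := by exact_mod_cast hg
  have hn0 : (0 : ℝ) < n := by exact_mod_cast hn
  have hα : 1 - alph g = g / (2 * g + 1) := by
    unfold alph; field_simp; ring
  have hα' : 1 - 2 * alph g = -(1 / (2 * (g : ℝ) + 1)) := by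
    unfold alph; field_simp; ring
  have hα0 : 1 - alph g ≠ 0 := by rw [hα]; positivity
  unfold glam
  rw [Real.mul_rpow (by positivity) (by positivity), Real.mul_rpow (by positivity) (by positivity),
    ← Real.rpow_mul (by linarith), ← Real.rpow_mul hn0.le, ← Real.rpow_mul hlog,
    div_mul_cancel₀ _ hα0, one_div_mul_cancel hα0, Real.rpow_one]
  have : (n : ℝ) ^ (1 / (g : ℝ) * (1 - alph g)) * (n : ℝ) ^ (1 - 2 * alph g) = 1 := by
    rw [← Real.rpow_add hn0, hα, hα', ← Real.rpow_zero (n : ℝ)]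
    congr 1; field_simp; ring
  linear_combination (lam ^ (2 * (g : ℝ) + 5) * Real.log n) * this

theorem stmt11 (g M : ℕ) (hg : 2 ≤ g) (hM : 1 ≤ M) (CM : Set (ZMod M))
    (hSidon : IsSidonZ CM) (hcov : Covers3 CM) :
    ∀ s : ℕ → Fin 3 → ZMod M, GoodS M CM s →
    ∀ lam : ℝ, 1 < lam → ∃ C : ℝ, 0 < C ∧ ∃ n₀ : ℕ, ∀ n : ℕ, n₀ ≤ n →
      (∑' x : ↥(TnDep g M lam s n),
          ∏ y ∈ imgF x.1, lam⁻¹ * (y : ℝ) ^ (-alph g))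
        ≤ C * (n : ℝ) ^ ((1 - 2 * alph g) * ((1 : ℝ) / (g : ℝ))) * Real.log n := by
  intro s hs lam hlam
  have hg' : (2 : ℝ) ≤ g := by exact_mod_cast hg
  have h0 : 1 / 2 < alph g := by
    unfold alph
    rw [div_lt_div_iff₀ (by norm_num) (by positivity)]; linarith
  have h1 : alph g < 1 := by
    unfold alph
    rw [div_lt_one (by positivity)]; linarith
  obtain ⟨C, hC, htail⟩ := sum_tailMaj_le h0 h1 hg
  obtain ⟨n₀, hn₀⟩ := Filter.eventually_atTop.1 (eventually_glam g hg hlam)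
  set α := alph g with hα
  have hlam0 : 0 < lam := by linarith
  refine ⟨2 * C * (2⁻¹ : ℝ) ^ (1 - 2 * α) *
    (3 * 2 ^ α * (4 ^ α) ^ 2 * lam ^ (2 * (g : ℝ) + 5)), by positivity, n₀, fun n hn => ?_⟩
  obtain ⟨n1, nl, nG, nG'⟩ := hn₀ n hn
  have hn0 : (0 : ℝ) < n := by exact_mod_cast n1
  have hG : 0 < glam g lam n := lt_of_lt_of_le (by positivity) nG
  have hω : ∀ k : ℕ, 0 ≤ lam⁻¹ * (k : ℝ) ^ (-α) := fun k => by positivity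
  have hw : ∀ k : ℕ, lam⁻¹ * (k : ℝ) ^ (-α) ≤ powWt α k := fun k =>
    mul_le_of_le_one_left (by positivity) (inv_le_one_of_one_le₀ hlam.le)
  have hts : (∑' x : ↥(TnDep g M lam s n), ∏ y ∈ imgF x.1, lam⁻¹ * (y : ℝ) ^ (-α)) =
      ∑ x ∈ (TnDep_finite g M lam s n).toFinset, ∏ y ∈ imgF x, lam⁻¹ * (y : ℝ) ^ (-α) := by
    rw [← Finset.tsum_subtype']
    rw [Set.Finite.coe_toFinset]
  rw [hts]
  have hmain := sum_TnDep_le h0 h1 hω hw hs hG nG' hC htail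
  have htrip := sum_triples_le (by linarith) hω hw hs n1 hG
  have hpow : (glam g lam n / 2) ^ (1 - 2 * α) ≤
      (2⁻¹ : ℝ) ^ (1 - 2 * α) * (n : ℝ) ^ ((1 - 2 * α) * ((1 : ℝ) / (g : ℝ))) := by
    rw [mul_comm (1 - 2 * α) ((1 : ℝ) / (g : ℝ)), Real.rpow_mul hn0.le,
      ← Real.mul_rpow (by norm_num) (by positivity)]
    exact Real.rpow_le_rpow_of_nonpos (by positivity) (by linarith) (by linarith)
  have hlog := glam_rpow_mul g hg hlam n1 (by linarith)
  refine hmain.trans ?_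
  calc _ ≤ 2 * C * ((2⁻¹ : ℝ) ^ (1 - 2 * α) * (n : ℝ) ^ ((1 - 2 * α) * ((1 : ℝ) / (g : ℝ)))) *
        (3 * 2 ^ α * (4 ^ α) ^ 2 * glam g lam n ^ (1 - α) * (n : ℝ) ^ (1 - 2 * α)) := by
        refine mul_le_mul (by gcongr) htrip
          (Finset.sum_nonneg fun t _ => Finset.prod_nonneg fun k _ => hω k) (by positivity)
    _ = _ := by
        linear_combination 2 * C * ((2⁻¹ : ℝ) ^ (1 - 2 * α) *
          (n : ℝ) ^ ((1 - 2 * α) * ((1 : ℝ) / (g : ℝ)))) * (3 * 2 ^ α * (4 ^ α) ^ 2) * hlog
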